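/- arXiv:2112.11799 — 6 statements merged into one kernel-verified Lean document; each statement's English description precedes it below -/
import Mathlib

section
/- Let (V, F) be a forest with n_comp connected components, let r ∈ V, and let D be a set of arcs (ordered pairs of distinct vertices of V) such that D contains both orientations (a,b) and (b,a) of every edge {a,b} ∈ F, and such that for every nonempty R ⊆ V \ {r} at least one arc of D enters R. Let S be the set of unordered pairs {a,b} with (a,b) ∈ D and {a,b} ∉ F. Then there exists S_tree ⊆ S with |S_tree| = n_comp − 1 such that (V, F ∪ S_tree) is a spanning tree of V. -/
/-- The simple graph on `V` whose edges are the members of a finite edge set `E`. -/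
abbrev EG {V : Type*} (E : Finset (Sym2 V)) : SimpleGraph V :=
  SimpleGraph.fromEdgeSet ↑E

namespace SimpleGraph

/-- In a finite forest the numbers of edges and of components add up to that of vertices. -/
theorem IsAcyclic.card_edgeSet_add_card_connectedComponent {V : Type*} [Finite V]
    {G : SimpleGraph V} (hG : G.IsAcyclic) :
    Nat.card G.edgeSet + Nat.card G.ConnectedComponent = Nat.card V := by
  classical
  have := Fintype.ofFinite V
  have hdeg : ∑ c : G.ConnectedComponent, ∑ v : c, c.toSimpleGraph.degree v =
      ∑ v : V, G.degree v := by
    rw [← Fintype.sum_fiberwise G.connectedComponentMk]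
    exact Finset.sum_congr rfl fun c _ ↦ Finset.sum_congr rfl fun v _ ↦ by
      convert degree_induce_of_neighborSet_subset fun _ hw ↦ c.mem_supp_of_adj_mem_supp v.2 hw <;> rfl
  have hcard : ∑ c : G.ConnectedComponent, Fintype.card c = Fintype.card V := by
    rw [← Fintype.card_sigma]
    exact Fintype.card_congr (Equiv.sigmaFiberEquiv G.connectedComponentMk)
  simp_rw [sum_degrees_eq_twice_card_edges, ← Finset.mul_sum] at hdeg
  simp_rw [← fun c ↦ (hG.isTree_connectedComponent c).card_edgeFinset, Finset.sum_add_distrib]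
    at hcard
  simp only [Finset.sum_const, Finset.card_univ, smul_eq_mul, mul_one] at hcard
  simp only [Nat.card_eq_fintype_card, ← edgeFinset_card]
  omega

/-- A graph is connected if every nonempty finite set of vertices avoiding a fixed vertex has an
edge leaving it. -/
theorem connected_of_forall_exists_adj_notMem {V : Type*} [Fintype V] {G : SimpleGraph V} (r : V)
    (h : ∀ R : Finset V, R.Nonempty → r ∉ R → ∃ a b, G.Adj a b ∧ b ∈ R ∧ a ∉ R) :
    G.Connected := by
  classical
  have hr : ∀ v, G.Reachable r v := by
    by_contra! hv
    obtain ⟨v, hv⟩ := hv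
    obtain ⟨a, b, hab, hb, ha⟩ := h {v | ¬ G.Reachable r v} ⟨v, by simpa using hv⟩ (by simp)
    simp only [Finset.mem_filter, Finset.mem_univ, true_and, not_not] at ha hb
    exact hb (ha.trans hab.reachable)
  exact (connected_iff_exists_forall_reachable G).mpr ⟨r, hr⟩

end SimpleGraph

/-- Let `(V, F)` be a forest with `n_comp` connected components, `r ∈ V`,
and let `D` be a set of arcs containing both orientations of every edge of `F` and such
that every nonempty `R ⊆ V \ {r}` has at least one arc of `D` entering it.  Let `S` be
the set of underlying unordered pairs of arcs of `D` that are not edges of `F`.  Then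
there is `S_tree ⊆ S` with `|S_tree| = n_comp - 1` such that `(V, F ∪ S_tree)` is a
spanning tree of `V`. -/
theorem stmt_3 {V : Type*} [Fintype V] [DecidableEq V]
    (F : Finset (Sym2 V)) (hFa : (EG F).IsAcyclic) (hFl : ∀ e ∈ F, ¬ e.IsDiag)
    (r : V)
    (D : Finset (V × V)) (hD : ∀ p ∈ D, p.1 ≠ p.2)
    (hFD : ∀ a b : V, s(a, b) ∈ F → (a, b) ∈ D ∧ (b, a) ∈ D)
    (hcut : ∀ R : Finset V, R.Nonempty → r ∉ R → ∃ p ∈ D, p.2 ∈ R ∧ p.1 ∉ R) :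
    ∃ Stree ⊆ (D.image fun p => s(p.1, p.2)) \ F,
      Stree.card = Nat.card (EG F).ConnectedComponent - 1 ∧
      (EG (F ∪ Stree)).IsTree := by
  classical
  set A := D.image fun p ↦ s(p.1, p.2)
  have hFA : F ⊆ A := fun e he ↦ by
    induction e with
    | _ a b => exact Finset.mem_image.mpr ⟨(a, b), (hFD a b he).1, rfl⟩
  have hconn : (EG A).Connected := by
    refine SimpleGraph.connected_of_forall_exists_adj_notMem r fun R hR hr ↦ ?_
    obtain ⟨p, hp, hb, ha⟩ := hcut R hR hr
    exact ⟨p.1, p.2, (SimpleGraph.fromEdgeSet_adj _).mpr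
      ⟨Finset.mem_image_of_mem (fun p ↦ s(p.1, p.2)) hp, hD p hp⟩, hb, ha⟩
  obtain ⟨T, hFT, hTA, hT⟩ := hconn.exists_isTree_le_of_le_of_isAcyclic
    (SimpleGraph.fromEdgeSet_mono (by exact_mod_cast hFA)) hFa
  have hFedge : (EG F).edgeSet = F := by
    ext e
    simpa using hFl e
  have hFsub : F ⊆ T.edgeFinset := fun e he ↦
    SimpleGraph.mem_edgeFinset.mpr (SimpleGraph.edgeSet_mono hFT (hFedge.ge he))
  have hunion : EG (F ∪ T.edgeFinset \ F) = T := by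
    rw [Finset.union_sdiff_of_subset hFsub]
    simp [EG]
  refine ⟨T.edgeFinset \ F, Finset.sdiff_subset_sdiff (fun e he ↦ ?_) le_rfl, ?_, ?_⟩
  · have := SimpleGraph.edgeSet_mono hTA (SimpleGraph.mem_edgeFinset.mp he)
    rw [SimpleGraph.edgeSet_fromEdgeSet] at this
    exact this.1
  · have hforest := hFa.card_edgeSet_add_card_connectedComponent
    have htree := hT.card_edgeFinset
    rw [Finset.card_sdiff_of_subset hFsub]
    rw [Nat.card_coe_set_eq, hFedge, Set.ncard_coe_finset, Nat.card_eq_fintype_card (α := V)] at hforest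
    omega
  · rwa [hunion]
end

section
/- Let (V, T) be a tree rooted at a vertex r, and let D be a finite set of arcs (ordered pairs of distinct vertices of V) such that for every edge e of T there exists an arc (a,b) ∈ D with b ∈ R_e and a ∉ R_e, where R_e is the vertex set of the connected component of T − e not containing r. Then the set U = { {c, b} : (a,b) ∈ D, c is the lowest common ancestor of a and b, and c ≠ b } satisfies: (i) |U| ≤ |D|; (ii) every pair {c, b} ∈ U is an up-link, i.e., c lies on the r–b path in T; and (iii) for every edge e of T there exists {c, b} ∈ U such that e lies on the path in T from c to b. -/
/-- `v` lies on the (unique, in a tree) `x`–`y` path in `G`. -/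
def LiesOnPath {V : Type*} (G : SimpleGraph V) (x y v : V) : Prop :=
  ∃ p : G.Walk x y, p.IsPath ∧ v ∈ p.support

/-- `c` is the lowest common ancestor of `a` and `b` in the tree `G` rooted at `r`. -/
def IsLCA {V : Type*} (G : SimpleGraph V) (r a b c : V) : Prop :=
  LiesOnPath G r a c ∧ LiesOnPath G r b c ∧
    ∀ v : V, LiesOnPath G r a v → LiesOnPath G r b v → LiesOnPath G r c v

/-- In an acyclic graph, a vertex on the path between two vertices that remain connected after
deleting a set of edges remains connected to them. -/
theorem LiesOnPath.reachable_deleteEdges {V : Type*} {G : SimpleGraph V} (hG : G.IsAcyclic)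
    {x y v : V} {s : Set (Sym2 V)} (hv : LiesOnPath G x y v)
    (hxy : (G.deleteEdges s).Reachable x y) : (G.deleteEdges s).Reachable x v := by
  classical
  obtain ⟨p, hp, hvp⟩ := hv
  obtain ⟨w, hw⟩ := hxy.exists_isPath
  have hle : G.deleteEdges s ≤ G := G.deleteEdges_le s
  have hpw : p = w.mapLe hle :=
    congrArg Subtype.val ((hG.subsingleton_path x y).elim ⟨p, hp⟩ ⟨w.mapLe hle, hw.mapLe hle⟩)
  rw [hpw, SimpleGraph.Walk.support_mapLe_eq_support] at hvp
  exact ⟨w.takeUntil v hvp⟩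

/-- Let `(V, T)` be a tree rooted at `r` and `D` a finite set of arcs
such that for every edge `e` of `T` some arc `(a,b) ∈ D` enters the component `R_e` of
`T − e` not containing `r`.  Let `U = { {lca a b, b} : (a,b) ∈ D, lca a b ≠ b }`.
Then (i) `|U| ≤ |D|`; (ii) every pair in `U` is an up-link, i.e. for `(a,b) ∈ D` with
`c = lca a b ≠ b`, the vertex `c` lies on the `r`–`b` path; and (iii) every edge of `T`
lies on the tree path from `lca a b` to `b` for some `(a,b) ∈ D` with `lca a b ≠ b`. -/
theorem stmt_6 {V : Type*} [Fintype V] [DecidableEq V]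
    (G : SimpleGraph V) (hG : G.IsTree) (r : V)
    (D : Finset (V × V)) (hD : ∀ p ∈ D, p.1 ≠ p.2)
    (lca : V → V → V) (hlca : ∀ a b : V, IsLCA G r a b (lca a b))
    (hcov : ∀ e ∈ G.edgeSet, ∃ p ∈ D,
      ¬ (G.deleteEdges {e}).Reachable p.2 r ∧ (G.deleteEdges {e}).Reachable p.1 r) :
    ((D.filter (fun p => lca p.1 p.2 ≠ p.2)).image
        (fun p => s(lca p.1 p.2, p.2))).card ≤ D.card ∧
    (∀ p ∈ D, lca p.1 p.2 ≠ p.2 → LiesOnPath G r p.2 (lca p.1 p.2)) ∧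
    (∀ e ∈ G.edgeSet, ∃ p ∈ D, lca p.1 p.2 ≠ p.2 ∧
      ∃ q : G.Walk (lca p.1 p.2) p.2, q.IsPath ∧ e ∈ q.edges) := by
  refine ⟨Finset.card_image_le.trans (Finset.card_filter_le _ _),
    fun p _ _ => (hlca p.1 p.2).2.1, fun e he => ?_⟩
  obtain ⟨p, hp, hb, ha⟩ := hcov e he
  have hc : (G.deleteEdges {e}).Reachable r (lca p.1 p.2) :=
    (hlca p.1 p.2).1.reachable_deleteEdges hG.isAcyclic ha.symm
  refine ⟨p, hp, fun h => hb (h ▸ hc).symm, ?_⟩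
  obtain ⟨q, hq⟩ := (hG.connected.preconnected (lca p.1 p.2) p.2).exists_isPath
  refine ⟨q, hq, ?_⟩
  by_contra hne
  exact hb (hc.trans ⟨q.toDeleteEdge e hne⟩).symm
end

section
/- Let (V, F) be a forest with n_comp ≥ 2 connected components and let S be a set of links (unordered pairs of distinct vertices of V) such that (V, F ∪ S) is 2-edge-connected. Then |S| ≥ n_comp + |{ ℓ ∈ S : both endpoints of ℓ lie in the same connected component of (V, F) }|. -/
/-- If a connected graph `K` has all its edges between distinct components of `G` in `T`, then
`G` has at most `T.card + 1` components. -/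
lemma card_connectedComponent_le_card_add_one {V : Type*} [Fintype V]
    (G K : SimpleGraph V) (hK : K.Connected) (T : Finset (Sym2 V))
    (hT : ∀ u v, K.Adj u v → ¬ G.Reachable u v → s(u, v) ∈ T) :
    Nat.card G.ConnectedComponent ≤ T.card + 1 := by
  classical
  let T' : Finset (Sym2 G.ConnectedComponent) := T.image (Sym2.map G.connectedComponentMk)
  let H : SimpleGraph G.ConnectedComponent := SimpleGraph.fromEdgeSet ↑T'
  have walk : ∀ u v, K.Walk u v →
      H.Reachable (G.connectedComponentMk u) (G.connectedComponentMk v) := by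
    intro u v p
    induction p with
    | nil => exact .refl _
    | @cons u v w h _ ih =>
      refine SimpleGraph.Reachable.trans ?_ ih
      by_cases hr : G.Reachable u v
      · rw [SimpleGraph.ConnectedComponent.eq.2 hr]
      · refine SimpleGraph.Adj.reachable ((SimpleGraph.fromEdgeSet_adj _).2 ⟨?_, ?_⟩)
        · exact Finset.mem_coe.2 (Finset.mem_image.2 ⟨s(u, v), hT u v h hr, rfl⟩)
        · exact fun h' => hr (SimpleGraph.ConnectedComponent.eq.1 h')
  have hH : H.Connected := by
    have := hK.nonempty
    have : Nonempty G.ConnectedComponent := ‹Nonempty V›.map G.connectedComponentMk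
    refine ⟨fun a b => ?_⟩
    induction a using SimpleGraph.ConnectedComponent.ind with | _ u
    induction b using SimpleGraph.ConnectedComponent.ind with | _ v
    obtain ⟨p⟩ := hK.preconnected u v
    exact walk u v p
  have hsub : H.edgeSet ⊆ ↑T' := by
    simp [H, SimpleGraph.edgeSet_fromEdgeSet]
  have hcard : Nat.card H.edgeSet ≤ T.card := by
    rw [Nat.card_coe_set_eq]
    refine (Set.ncard_le_ncard hsub T'.finite_toSet).trans ?_
    rw [Set.ncard_coe_finset]
    exact Finset.card_image_le
  have := hH.card_vert_le_card_edgeSet_add_one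
  omega


/-- A graph is 2-edge-connected if it has at least two vertices, is connected, and
remains connected after the deletion of any single edge. -/
def TwoEdgeConnected {V : Type*} [Fintype V] (G : SimpleGraph V) : Prop :=
  2 ≤ Fintype.card V ∧ G.Connected ∧ ∀ e ∈ G.edgeSet, (G.deleteEdges {e}).Connected

/-- Let `(V, F)` be a forest with `n_comp ≥ 2` connected components and
`S` a set of links such that `(V, F ∪ S)` is 2-edge-connected.  Then
`|S| ≥ n_comp + #{ℓ ∈ S : both endpoints of ℓ lie in the same component of (V, F)}`. -/
theorem stmt_8 {V : Type*} [Fintype V] [DecidableEq V]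
    (F : Finset (Sym2 V)) (hFa : (EG F).IsAcyclic) (hFl : ∀ e ∈ F, ¬ e.IsDiag)
    (hcomp : 2 ≤ Nat.card (EG F).ConnectedComponent)
    (S : Finset (Sym2 V)) (hSl : ∀ e ∈ S, ¬ e.IsDiag)
    (h2ec : TwoEdgeConnected (EG (F ∪ S))) :
    Nat.card (EG F).ConnectedComponent +
      {e ∈ (S : Set (Sym2 V)) | ∃ a b : V, e = s(a, b) ∧ (EG F).Reachable a b}.ncard
      ≤ S.card := by
  classical
  let bad : Sym2 V → Prop := fun e => ∃ a b : V, e = s(a, b) ∧ (EG F).Reachable a b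
  let T := S.filter fun e => ¬ bad e
  have hbad : {e ∈ (S : Set (Sym2 V)) | bad e}.ncard = (S.filter bad).card := by
    rw [← Set.ncard_coe_finset, Finset.coe_filter]
    rfl
  have hsum : (S.filter bad).card + T.card = S.card :=
    Finset.card_filter_add_card_filter_not _
  have hT : ∀ u v, (EG (F ∪ S)).Adj u v → ¬ (EG F).Reachable u v → s(u, v) ∈ T := by
    intro u v h hr
    have h' := (SimpleGraph.fromEdgeSet_adj _).1 h
    have hF : s(u, v) ∉ F := fun hF =>
      hr (SimpleGraph.Adj.reachable ((SimpleGraph.fromEdgeSet_adj _).2 ⟨hF, h'.2⟩))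
    have hS : s(u, v) ∈ S := (Finset.mem_union.1 (Finset.mem_coe.1 h'.1)).resolve_left hF
    refine Finset.mem_filter.2 ⟨hS, ?_⟩
    rintro ⟨a, b, hab, hr'⟩
    rcases Sym2.eq_iff.1 hab with ⟨rfl, rfl⟩ | ⟨rfl, rfl⟩
    · exact hr hr'
    · exact hr hr'.symm
  obtain ⟨-, hconn, hdel⟩ := h2ec
  have hpos := card_connectedComponent_le_card_add_one _ _ hconn T hT
  obtain ⟨e, he⟩ : T.Nonempty := Finset.card_pos.1 (by omega)
  have heS : e ∈ S := (Finset.mem_filter.1 he).1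
  have heG : e ∈ (EG (F ∪ S)).edgeSet := by
    rw [SimpleGraph.edgeSet_fromEdgeSet]
    exact ⟨Finset.mem_coe.2 (Finset.mem_union_right _ heS), hSl e heS⟩
  have hle := card_connectedComponent_le_card_add_one (EG F) _ (hdel e heG) (T.erase e) (by
    intro u v h hr
    rw [SimpleGraph.deleteEdges_adj] at h
    exact Finset.mem_erase.2 ⟨h.2, hT u v h.1 hr⟩)
  have := Finset.card_erase_add_one he
  change _ + {e ∈ (S : Set (Sym2 V)) | bad e}.ncard ≤ _
  omega
end

section
/- Let (V, F) be a graph all of whose connected components are paths containing at least one edge, with n_comp connected components, and let L be a set of links (unordered pairs of distinct vertices of V). Suppose OPT ⊆ L is such that (V, F ∪ OPT) is 2-edge-connected. Let M_OPT ⊆ OPT be a matching, each of whose edges joins two leaves of (V, F) lying in distinct connected components of (V, F), that is maximal with this property (no further edge of OPT joining two leaves of distinct components can be added to M_OPT so that it remains a matching). Then |OPT| ≥ |M_OPT| + u − b, where u is the number of leaves of (V, F) not covered by M_OPT and b is the number of links in OPT with both endpoints in the same connected component of (V, F). -/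
/-- Degree of `v` in the graph with edge set `F`. -/
noncomputable def degE {V : Type*} (F : Finset (Sym2 V)) (v : V) : ℕ :=
  ((EG F).neighborSet v).ncard

/-- Every connected component of `(V, F)` is a path containing at least one edge. -/
def PathForest {V : Type*} (F : Finset (Sym2 V)) : Prop :=
  (EG F).IsAcyclic ∧ (∀ e ∈ F, ¬ e.IsDiag) ∧ ∀ v : V, degE F v = 1 ∨ degE F v = 2

/-- `M` is a matching. -/
def IsMatchingOn {V : Type*} (M : Finset (Sym2 V)) : Prop :=
  (∀ e ∈ M, ¬ e.IsDiag) ∧ ∀ e ∈ M, ∀ f ∈ M, e ≠ f → ∀ v : V, v ∈ e → v ∉ f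

/-- `e` joins two leaves of `(V, F)` lying in distinct connected components. -/
def JoinsTwoLeaves {V : Type*} (F : Finset (Sym2 V)) (e : Sym2 V) : Prop :=
  ∃ a b : V, e = s(a, b) ∧ degE F a = 1 ∧ degE F b = 1 ∧ ¬ (EG F).Reachable a b

/-- In a 2-edge-connected graph `(V, F ∪ O)`, every leaf of `(V, F)` is covered by `O`. -/
theorem exists_mem_of_degE_eq_one {V : Type*} [Fintype V] [DecidableEq V]
    {F O : Finset (Sym2 V)} (h : TwoEdgeConnected (EG (F ∪ O))) {v : V} (hv : degE F v = 1) :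
    ∃ e ∈ O, v ∈ e := by
  obtain ⟨w, hw⟩ := Set.ncard_eq_one.mp hv
  have hvw : (EG F).Adj v w := by
    rw [← SimpleGraph.mem_neighborSet, hw]
    rfl
  have hmem : s(v, w) ∈ (EG (F ∪ O)).edgeSet := by
    simp only [EG, SimpleGraph.mem_edgeSet, SimpleGraph.fromEdgeSet_adj] at hvw ⊢
    exact ⟨by simpa using Or.inl hvw.1, hvw.2⟩
  have : Nontrivial V := Fintype.one_lt_card_iff_nontrivial.mp h.1
  obtain ⟨x, hx⟩ := (h.2.2 _ hmem).preconnected.exists_adj_of_nontrivial v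
  rw [SimpleGraph.deleteEdges_adj, SimpleGraph.fromEdgeSet_adj] at hx
  obtain ⟨⟨hxmem, hne⟩, hxe⟩ := hx
  rcases Finset.mem_union.mp (Finset.mem_coe.mp hxmem) with hxF | hxO
  · have hxw : x ∈ (EG F).neighborSet v :=
      (SimpleGraph.fromEdgeSet_adj _).mpr ⟨Finset.mem_coe.mpr hxF, hne⟩
    rw [hw, Set.mem_singleton_iff] at hxw
    exact absurd (by simp [hxw]) hxe
  · exact ⟨_, hxO, Sym2.mem_mk_left v x⟩

/-- Adding to a matching an edge between two distinct uncovered vertices gives a matching. -/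
theorem IsMatchingOn.insert_of_uncovered {V : Type*} [DecidableEq V] {M : Finset (Sym2 V)}
    (hM : IsMatchingOn M) {a b : V} (hab : a ≠ b) (ha : ∀ e ∈ M, a ∉ e) (hb : ∀ e ∈ M, b ∉ e) :
    IsMatchingOn (insert s(a, b) M) := by
  have key : ∀ f ∈ M, ∀ v ∈ s(a, b), v ∉ f := by
    intro f hf v hv
    rcases Sym2.mem_iff.mp hv with rfl | rfl
    exacts [ha f hf, hb f hf]
  refine ⟨fun e he => ?_, fun e he f hf hef v hve hvf => ?_⟩
  · rcases Finset.mem_insert.mp he with rfl | he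
    exacts [by simpa using hab, hM.1 e he]
  · rcases Finset.mem_insert.mp he with rfl | he <;> rcases Finset.mem_insert.mp hf with rfl | hf
    exacts [hef rfl, key f hf v hve hvf, key e he v hvf hve, hM.2 e he f hf hef v hve hvf]

/-- An unordered pair contains at most two elements of a finite set. -/
theorem Sym2.card_filter_mem_le_two {V : Type*} [DecidableEq V] (U : Finset V) (e : Sym2 V) :
    {v ∈ U | v ∈ e}.card ≤ 2 := by
  induction e using Sym2.ind with
  | _ x y =>
    refine (Finset.card_le_card (t := {x, y}) fun v hv => ?_).trans Finset.card_le_two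
    simpa using (Finset.mem_filter.mp hv).2

/-- With every component of `(V, F)` a path with at least one edge and
`(V, F ∪ OPT)` 2-edge-connected, let `M_OPT ⊆ OPT` be a matching whose edges join leaves
of distinct components, maximal with this property.  Then
`|OPT| ≥ |M_OPT| + u − b`, where `u` is the number of leaves of `(V, F)` not covered by
`M_OPT` and `b` is the number of links of `OPT` with both endpoints in the same
component of `(V, F)`. -/
theorem stmt_9 {V : Type*} [Fintype V] [DecidableEq V]
    (F L : Finset (Sym2 V)) (hF : PathForest F) (hL : ∀ e ∈ L, ¬ e.IsDiag)
    (OPT : Finset (Sym2 V)) (hOPTL : OPT ⊆ L)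
    (hOPT : TwoEdgeConnected (EG (F ∪ OPT)))
    (MOPT : Finset (Sym2 V)) (hMO : MOPT ⊆ OPT) (hM : IsMatchingOn MOPT)
    (hMleaves : ∀ e ∈ MOPT, JoinsTwoLeaves F e)
    (hMmaximal : ∀ e ∈ OPT, e ∉ MOPT → JoinsTwoLeaves F e →
      ¬ IsMatchingOn (insert e MOPT)) :
    (MOPT.card : ℤ) +
        {v : V | degE F v = 1 ∧ ∀ e ∈ MOPT, v ∉ e}.ncard -
        {e ∈ (OPT : Set (Sym2 V)) | ∃ a b : V, e = s(a, b) ∧ (EG F).Reachable a b}.ncard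
      ≤ OPT.card := by
  classical
  set U : Finset V := {v : V | degE F v = 1 ∧ ∀ e ∈ MOPT, v ∉ e} with hU
  set B : Finset (Sym2 V) := {e ∈ OPT | ∃ a b : V, e = s(a, b) ∧ (EG F).Reachable a b} with hB
  have hUcard : {v : V | degE F v = 1 ∧ ∀ e ∈ MOPT, v ∉ e}.ncard = U.card := by
    rw [← Set.ncard_coe_finset, hU]
    simp
  have hBcard : {e ∈ (OPT : Set (Sym2 V)) |
      ∃ a b : V, e = s(a, b) ∧ (EG F).Reachable a b}.ncard = B.card := by
    rw [← Set.ncard_coe_finset, hB]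
    simp
  have hcover : ∀ v ∈ U, 1 ≤ {e ∈ OPT \ MOPT | v ∈ e}.card := by
    intro v hv
    obtain ⟨hdeg, hunc⟩ := (Finset.mem_filter.mp hv).2
    obtain ⟨e, heO, hve⟩ := exists_mem_of_degE_eq_one hOPT hdeg
    exact Finset.card_pos.mpr ⟨e, Finset.mem_filter.mpr
      ⟨Finset.mem_sdiff.mpr ⟨heO, fun heM => hunc e heM hve⟩, hve⟩⟩
  have hlink : ∀ e ∈ OPT \ MOPT, {v ∈ U | v ∈ e}.card ≤ 1 + if e ∈ B then 1 else 0 := by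
    intro e he
    obtain ⟨heO, heM⟩ := Finset.mem_sdiff.mp he
    split_ifs with heB
    · exact Sym2.card_filter_mem_le_two U e
    · refine Finset.card_le_one.mpr fun a ha b hb => ?_
      by_contra hab
      obtain ⟨haU, hae⟩ := Finset.mem_filter.mp ha
      obtain ⟨hbU, hbe⟩ := Finset.mem_filter.mp hb
      obtain ⟨hda, hua⟩ := (Finset.mem_filter.mp haU).2
      obtain ⟨hdb, hub⟩ := (Finset.mem_filter.mp hbU).2
      obtain rfl : e = s(a, b) := (Sym2.mem_and_mem_iff hab).mp ⟨hae, hbe⟩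
      have hnr : ¬ (EG F).Reachable a b := fun hr =>
        heB (Finset.mem_filter.mpr ⟨heO, a, b, rfl, hr⟩)
      exact hMmaximal _ heO heM ⟨a, b, rfl, hda, hdb, hnr⟩ (hM.insert_of_uncovered hab hua hub)
  have hcount : U.card ≤ (OPT \ MOPT).card + B.card := calc
    U.card = ∑ v ∈ U, 1 := Finset.card_eq_sum_ones U
    _ ≤ ∑ v ∈ U, {e ∈ OPT \ MOPT | v ∈ e}.card := Finset.sum_le_sum hcover
    _ = ∑ e ∈ OPT \ MOPT, {v ∈ U | v ∈ e}.card :=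
      Finset.sum_card_bipartiteAbove_eq_sum_card_bipartiteBelow (fun v e => v ∈ e)
    _ ≤ ∑ e ∈ OPT \ MOPT, (1 + if e ∈ B then 1 else 0) := Finset.sum_le_sum hlink
    _ = (OPT \ MOPT).card + {e ∈ OPT \ MOPT | e ∈ B}.card := by
      rw [Finset.sum_add_distrib, ← Finset.card_eq_sum_ones, Finset.card_filter]
    _ ≤ (OPT \ MOPT).card + B.card := by
      gcongr
      exact fun e he => (Finset.mem_filter.mp he).2
  have hsplit := Finset.card_sdiff_add_card_eq_card hMO
  rw [hUcard, hBcard]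
  omega
end

section
/- Let (V, F) be a graph all of whose connected components are paths containing at least one edge, and let M be a matching on V, disjoint from F, such that every edge of M joins two leaves of (V, F) and no edge of M joins the two leaves of one and the same connected component of (V, F). Then every connected component of (V, F ∪ M) is either a path or a cycle, and every connected component of (V, F ∪ M) that is a cycle contains at least two edges of M. -/
/-- The connected component of `H` containing `v` is a path: there is a path of `H`
through `v` whose support is the whole component and whose edges are all the edges of
`H` within the component. -/
def CompIsPath {V : Type*} (H : SimpleGraph V) (v : V) : Prop :=
  ∃ (x y : V) (p : H.Walk x y), p.IsPath ∧ v ∈ p.support ∧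
    (∀ u : V, H.Reachable v u → u ∈ p.support) ∧
    (∀ a b : V, H.Adj a b → H.Reachable v a → s(a, b) ∈ p.edges)

/-- The connected component of `H` containing `v` is a cycle: there is a cycle of `H`
through `v` whose support is the whole component and whose edges are all the edges of
`H` within the component. -/
def CompIsCycle {V : Type*} (H : SimpleGraph V) (v : V) : Prop :=
  ∃ (x : V) (c : H.Walk x x), c.IsCycle ∧ v ∈ c.support ∧
    (∀ u : V, H.Reachable v u → u ∈ c.support) ∧
    (∀ a b : V, H.Adj a b → H.Reachable v a → s(a, b) ∈ c.edges)

namespace SimpleGraph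

variable {V : Type*} {H : SimpleGraph V}

/-- If all degrees are at most two, a walk using two edges at `a` uses every edge at `a`. -/
lemma Walk.mem_edges_of_two_le_ncard [Finite V] (hH : ∀ a, (H.neighborSet a).ncard ≤ 2)
    {x y a b : V} (p : H.Walk x y) (hp : 2 ≤ (p.toSubgraph.neighborSet a).ncard)
    (hab : H.Adj a b) : s(a, b) ∈ p.edges := by
  have heq : p.toSubgraph.neighborSet a = H.neighborSet a :=
    Set.eq_of_subset_of_ncard_le (p.toSubgraph.neighborSet_subset a) ((hH a).trans hp)
      (Set.toFinite _)
  have hb : b ∈ p.toSubgraph.neighborSet a := heq ▸ hab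
  exact Walk.adj_toSubgraph_iff_mem_edges.mp hb

/-- If all degrees are at most two, a path uses every edge at each of its inner vertices. -/
lemma Walk.IsPath.mem_edges_of_internal [Finite V] (hH : ∀ a, (H.neighborSet a).ncard ≤ 2)
    {x y a b : V} {p : H.Walk x y} (hp : p.IsPath) (ha : a ∈ p.support) (hx : a ≠ x)
    (hy : a ≠ y) (hab : H.Adj a b) : s(a, b) ∈ p.edges := by
  obtain ⟨i, rfl, hi⟩ := Walk.mem_support_iff_exists_getVert.mp ha
  refine p.mem_edges_of_two_le_ncard hH
    (hp.ncard_neighborSet_toSubgraph_internal_eq_two ?_ ?_).ge hab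
  · rintro rfl
    simp at hx
  · refine lt_of_le_of_ne hi ?_
    rintro rfl
    simp at hy

/-- The support of a walk that uses every edge at each of its vertices is closed under
reachability. -/
lemma Walk.mem_support_of_reachable {x y v u : V} (p : H.Walk x y)
    (hp : ∀ a ∈ p.support, ∀ b, H.Adj a b → s(a, b) ∈ p.edges)
    (hv : v ∈ p.support) (h : H.Reachable v u) : u ∈ p.support := by
  obtain ⟨q⟩ := h
  induction q with
  | nil => exact hv
  | cons hadj _ ih => exact ih (p.snd_mem_support_of_mem_edges (hp _ hv _ hadj))

/-- If all degrees are at most two and no cycle passes through `v`, a path through `v` of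
maximal length uses every edge at its first vertex. -/
lemma Walk.IsPath.mem_edges_start_of_maximal [Finite V]
    (hH : ∀ a, (H.neighborSet a).ncard ≤ 2) {v x y b : V} {p : H.Walk x y} (hp : p.IsPath)
    (hv : v ∈ p.support)
    (hmax : ∀ (x' y' : V) (q : H.Walk x' y'), q.IsPath → v ∈ q.support → q.length ≤ p.length)
    (hcyc : ∀ (x' : V) (c : H.Walk x' x'), c.IsCycle → v ∉ c.support)
    (hxb : H.Adj x b) : s(x, b) ∈ p.edges := by
  by_contra hne
  have hb : b ∈ p.support := by
    by_contra hb
    have := hmax _ _ (Walk.cons hxb.symm p) (hp.cons hb) (by simp [hv])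
    simp at this
  obtain rfl | hby := eq_or_ne b y
  · refine hcyc _ (Walk.cons hxb.symm p) ?_ (by simp [hv])
    rw [Walk.cons_isCycle_iff]
    exact ⟨hp, by rwa [Sym2.eq_swap]⟩
  · exact hne (Sym2.eq_swap ▸ hp.mem_edges_of_internal hH hb hxb.ne' hby hxb.symm)

/-- In a finite graph with all degrees at most two, every component is a path or a cycle. -/
lemma compIsPath_or_compIsCycle [Finite V] (hH : ∀ a, (H.neighborSet a).ncard ≤ 2) (v : V) :
    CompIsPath H v ∨ CompIsCycle H v := by
  classical
  have := Fintype.ofFinite V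
  by_cases hcyc : ∃ (x : V) (c : H.Walk x x), c.IsCycle ∧ v ∈ c.support
  · obtain ⟨x, c, hc, hv⟩ := hcyc
    have hcl : ∀ a ∈ c.support, ∀ b, H.Adj a b → s(a, b) ∈ c.edges := fun a ha b hab ↦
      c.mem_edges_of_two_le_ncard hH (hc.ncard_neighborSet_toSubgraph_eq_two ha).ge hab
    exact .inr ⟨x, c, hc, hv, fun u ↦ c.mem_support_of_reachable hcl hv,
      fun a b hab ha ↦ hcl a (c.mem_support_of_reachable hcl hv ha) b hab⟩
  · push Not at hcyc
    let S : Set ℕ := {n | ∃ (x y : V) (p : H.Walk x y), p.IsPath ∧ v ∈ p.support ∧ p.length = n}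
    have hbdd : BddAbove S := by
      refine ⟨Fintype.card V, ?_⟩
      rintro n ⟨x, y, p, hp, -, rfl⟩
      exact hp.length_lt.le
    have hne : S.Nonempty := ⟨0, v, v, Walk.nil, by simp⟩
    obtain ⟨x, y, p, hp, hv, hlen⟩ := Nat.sSup_mem hne hbdd
    have hmax (x' y' : V) (q : H.Walk x' y') (hq : q.IsPath) (hvq : v ∈ q.support) :
        q.length ≤ p.length := hlen ▸ le_csSup hbdd ⟨x', y', q, hq, hvq, rfl⟩
    have hcl : ∀ a ∈ p.support, ∀ b, H.Adj a b → s(a, b) ∈ p.edges := by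
      intro a ha b hab
      obtain rfl | hx := eq_or_ne a x
      · exact hp.mem_edges_start_of_maximal hH hv hmax hcyc hab
      obtain rfl | hy := eq_or_ne a y
      · simpa using hp.reverse.mem_edges_start_of_maximal hH (by simpa using hv)
          (by simpa using hmax) hcyc hab
      exact hp.mem_edges_of_internal hH ha hx hy hab
    exact .inl ⟨x, y, p, hp, hv, fun u ↦ p.mem_support_of_reachable hcl hv,
      fun a b hab ha ↦ hcl a (p.mem_support_of_reachable hcl hv ha) b hab⟩

end SimpleGraph

open SimpleGraph

/-- A matching has at most one edge at each vertex. -/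
lemma IsMatchingOn.eq_of_mem {V : Type*} {M : Finset (Sym2 V)} (hM : IsMatchingOn M)
    {a b c : V} (hb : s(a, b) ∈ M) (hc : s(a, c) ∈ M) : b = c := by
  by_contra hbc
  exact hM.2 _ hb _ hc (mt Sym2.congr_right.mp hbc) a (by simp) (by simp)

/-- Adding to a path forest a matching between leaves keeps all degrees at most two. -/
lemma ncard_neighborSet_union_le_two {V : Type*} [Finite V] [DecidableEq V]
    {F M : Finset (Sym2 V)} (hF : PathForest F) (hM : IsMatchingOn M)
    (hleaf : ∀ a b, s(a, b) ∈ M → degE F a = 1) (v : V) :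
    ((EG (F ∪ M)).neighborSet v).ncard ≤ 2 := by
  by_cases h : ∃ w, s(v, w) ∈ M
  · obtain ⟨w, hw⟩ := h
    have hsub : (EG (F ∪ M)).neighborSet v ⊆ insert w ((EG F).neighborSet v) := by
      rintro u ⟨hu, hne⟩
      rcases Finset.mem_union.mp (Finset.mem_coe.mp hu) with hu | hu
      · exact .inr ⟨hu, hne⟩
      · exact .inl (hM.eq_of_mem hu hw)
    have hdeg : ((EG F).neighborSet v).ncard = 1 := hleaf v w hw
    have := Set.ncard_le_ncard hsub (Set.toFinite _)
    have := Set.ncard_insert_le w ((EG F).neighborSet v)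
    lia
  · push Not at h
    have hsub : (EG (F ∪ M)).neighborSet v ⊆ (EG F).neighborSet v := by
      rintro u ⟨hu, hne⟩
      rcases Finset.mem_union.mp (Finset.mem_coe.mp hu) with hu | hu
      · exact ⟨hu, hne⟩
      · exact absurd hu (h u)
    have hle := Set.ncard_le_ncard hsub (Set.toFinite _)
    have hdeg := hF.2.2 v
    unfold degE at hdeg
    lia

/-- Let every component of `(V, F)` be a path with at least one edge,
and let `M` be a matching disjoint from `F` whose edges join leaves of `(V, F)`, no edge
of `M` joining the two leaves of one and the same component of `(V, F)`.  Then every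
component of `(V, F ∪ M)` is a path or a cycle, and every component of `(V, F ∪ M)`
that is a cycle contains at least two edges of `M`. -/
theorem stmt_11 {V : Type*} [Fintype V] [DecidableEq V]
    (F M : Finset (Sym2 V)) (hF : PathForest F)
    (hM : IsMatchingOn M) (hdisj : ∀ e ∈ M, e ∉ F)
    (hMleaves : ∀ e ∈ M, ∃ a b : V, e = s(a, b) ∧ degE F a = 1 ∧ degE F b = 1 ∧
      ¬ (EG F).Reachable a b) :
    (∀ v : V, CompIsPath (EG (F ∪ M)) v ∨ CompIsCycle (EG (F ∪ M)) v) ∧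
    (∀ v : V, CompIsCycle (EG (F ∪ M)) v →
      2 ≤ {e ∈ (M : Set (Sym2 V)) | ∀ w ∈ e, (EG (F ∪ M)).Reachable v w}.ncard) := by
  constructor
  · refine compIsPath_or_compIsCycle (ncard_neighborSet_union_le_two hF hM fun a b hab ↦ ?_)
    obtain ⟨x, y, hxy, hx, hy, -⟩ := hMleaves _ hab
    obtain ⟨rfl, -⟩ | ⟨rfl, -⟩ := Sym2.eq_iff.mp hxy
    exacts [hx, hy]
  · rintro v ⟨x, c, hc, hvc, -, -⟩
    set S := {e ∈ (M : Set (Sym2 V)) | ∀ w ∈ e, (EG (F ∪ M)).Reachable v w}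
    have hreach (w : V) (hw : w ∈ c.support) : (EG (F ∪ M)).Reachable v w :=
      (c.takeUntil v hvc).reachable.symm.trans (c.takeUntil w hw).reachable
    by_contra! hlt
    have hsub : S.Subsingleton := by
      rw [← Set.ncard_le_one_iff_subsingleton]
      lia
    obtain ⟨e, hec, heM⟩ : ∃ e ∈ c.edges, e ∈ M := by
      by_contra! hno
      have hcF : ∀ e ∈ c.edges, e ∈ (EG F).edgeSet := by
        intro e he
        have := c.edges_subset_edgeSet he
        simp only [edgeSet_fromEdgeSet, Set.mem_sdiff, Finset.mem_coe, Finset.mem_union] at this ⊢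
        exact ⟨this.1.resolve_right (hno e he), this.2⟩
      exact hF.1 _ (hc.transfer hcF)
    obtain ⟨a, b, rfl, -, -, hab⟩ := hMleaves e heM
    have haS : s(a, b) ∈ S := by
      refine ⟨heM, fun w hw ↦ hreach w ?_⟩
      obtain rfl | rfl := Sym2.mem_iff.mp hw
      exacts [c.fst_mem_support_of_mem_edges hec, c.snd_mem_support_of_mem_edges hec]
    obtain ⟨p, hp⟩ := reachable_deleteEdges_iff_exists_walk.mp
      (adj_and_reachable_delete_edges_iff_exists_cycle.mpr ⟨x, c, hc, hec⟩).2
    have hpF : ∀ e ∈ p.edges, e ∈ (EG F).edgeSet := by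
      intro e he
      have heU := p.edges_subset_edgeSet he
      simp only [edgeSet_fromEdgeSet, Set.mem_sdiff, Finset.mem_coe, Finset.mem_union] at heU ⊢
      refine ⟨heU.1.resolve_right fun heM' ↦ hp ?_, heU.2⟩
      have heS : e ∈ S := ⟨heM', fun w hw ↦
        (haS.2 a (by simp)).trans (p.takeUntil w (Walk.mem_support_of_mem_edges he hw)).reachable⟩
      exact hsub heS haS ▸ he
    exact hab (p.transfer _ hpF).reachable
end

section
/- Let G be a finite graph and let T be a subtree of G. Let x be a leaf of T and let z be a vertex of T distinct from x. Let P^{xz} be the edge set of the unique x–z path in T, let ℓ_1, …, ℓ_l be designated edges of P^{xz} (listed in order of increasing distance from x along the path), and write ℓ_i = {u_i, v_i} where u_i is the endpoint of ℓ_i closer to x on the path. Let P be an alternating x–z trail. Then the symmetric difference P △ P^{xz} is the edge set of a cycle in G whose vertex set is exactly the set of all vertices visited by P or by P^{xz}. -/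
/-- The interior vertices of a walk: all vertices of its support except the two
endpoints. -/
def walkInterior {V : Type*} {G : SimpleGraph V} {a b : V} (w : G.Walk a b) : List V :=
  w.support.tail.dropLast

/-- `AltDecomp G TE TV D a z P` says that the walk `P` from `a` to `z` decomposes
alternatingly into (i) paths none of whose edges belong to `TE` and all of whose
interior vertices lie outside `TV`, and (ii) designated edges `(u, v)` (traversed from
`v` to `u`), where the designated edges used are taken from the list `D` in order
(i.e. they appear along `P` in order of increasing position in `D`). -/
inductive AltDecomp {V : Type*} (G : SimpleGraph V) (TE : Set (Sym2 V)) (TV : Set V) :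
    List (V × V) → (a : V) → (z : V) → G.Walk a z → Prop
  | last (rem : List (V × V)) (a z : V) (q : G.Walk a z)
      (hq : q.IsPath) (hqE : ∀ e ∈ q.edges, e ∉ TE)
      (hqI : ∀ w ∈ walkInterior q, w ∉ TV) :
      AltDecomp G TE TV rem a z q
  | cons (rem₁ rem₂ : List (V × V)) (a v u z : V) (q : G.Walk a v)
      (hq : q.IsPath) (hqE : ∀ e ∈ q.edges, e ∉ TE)
      (hqI : ∀ w ∈ walkInterior q, w ∉ TV)
      (huv : G.Adj v u) (rest : G.Walk u z)
      (hrest : AltDecomp G TE TV rem₂ u z rest) :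
      AltDecomp G TE TV (rem₁ ++ (u, v) :: rem₂) a z
        (q.append (SimpleGraph.Walk.cons huv rest))

/-- `P` is an alternating `x`–`z` trail (with respect to the tree with edge set `TE` and
vertex set `TV`, and the designated edges `D` listed in order of increasing distance
from `x`): `P` is a trail, decomposes alternatingly as above, and visits every vertex
outside `TV` at most once. -/
def IsAlternatingTrail {V : Type*} [DecidableEq V] (G : SimpleGraph V)
    (TE : Set (Sym2 V)) (TV : Set V) (D : List (V × V)) {x z : V} (P : G.Walk x z) :
    Prop :=
  P.IsTrail ∧ AltDecomp G TE TV D x z P ∧ ∀ v : V, v ∉ TV → P.support.count v ≤ 1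

section AlternatingTrail

open SimpleGraph

variable {V : Type*} {G : SimpleGraph V}

theorem mem_walkInterior_of_mem_support {a b y : V} (w : G.Walk a b) (hy : y ∈ w.support) :
    y = a ∨ y = b ∨ y ∈ walkInterior w := by
  cases w with
  | nil => simp_all
  | cons h p =>
    rw [Walk.support_cons, List.mem_cons] at hy
    rcases hy with rfl | hy
    · exact Or.inl rfl
    · right
      have hne : p.support ≠ [] := p.support_ne_nil
      rw [← List.dropLast_append_getLast hne, List.mem_append, List.mem_singleton,
        Walk.getLast_support] at hy
      exact hy.symm

theorem isPath_append {a b c : V} {p : G.Walk a b} {r : G.Walk b c} (hp : p.IsPath)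
    (hr : r.IsPath) (h : ∀ y ∈ p.support, y ∈ r.support → y = b) : (p.append r).IsPath := by
  rw [Walk.isPath_def, Walk.support_append]
  have hr' := hr.support_nodup
  rw [← Walk.cons_tail_support, List.nodup_cons] at hr'
  refine List.Nodup.append hp.support_nodup hr'.2 fun y hy hyr => ?_
  have := h y hy (List.mem_of_mem_tail hyr)
  exact hr'.1 (this ▸ hyr)

theorem exists_eq_append_cons_of_sublist_darts {b z u v : V} {R : List (V × V)} (q : G.Walk b z)
    (h : ((u, v) :: R).Sublist (q.darts.map Dart.toProd)) :
    ∃ (huv : G.Adj u v) (s : G.Walk b u) (r : G.Walk v z),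
      q = s.append (.cons huv r) ∧ R.Sublist (r.darts.map Dart.toProd) := by
  induction q with
  | nil => simp at h
  | @cons b c z hbc p ih =>
    rw [Walk.darts_cons, List.map_cons, List.cons_sublist_cons'] at h
    rcases h with h | ⟨h, hR⟩
    · obtain ⟨huv, s, r, rfl, hr⟩ := ih h
      exact ⟨huv, .cons hbc s, r, rfl, hr⟩
    · obtain ⟨rfl, rfl⟩ := Prod.mk.inj h
      exact ⟨hbc, .nil, p, rfl, hR⟩

theorem AltDecomp.eq_or_mem_of_mem_support {TE : Set (Sym2 V)} {TV : Set V} {D : List (V × V)}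
    {a z : V} {P : G.Walk a z} (hP : AltDecomp G TE TV D a z P) {y : V} (hy : y ∈ P.support)
    (hyT : y ∈ TV) : y = a ∨ y = z ∨ ∃ d ∈ D, y = d.1 ∨ y = d.2 := by
  induction hP with
  | last rem a z q hq hqE hqI =>
    rcases mem_walkInterior_of_mem_support q hy with h | h | h
    · exact Or.inl h
    · exact Or.inr (Or.inl h)
    · exact absurd hyT (hqI _ h)
  | cons rem₁ rem₂ a v u z q hq hqE hqI huv rest hrest ih =>
    rw [Walk.mem_support_append_iff, Walk.support_cons, List.mem_cons] at hy
    have hmem : (u, v) ∈ rem₁ ++ (u, v) :: rem₂ := by simp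
    rcases hy with hy | rfl | hy
    · rcases mem_walkInterior_of_mem_support q hy with h | h | h
      · exact Or.inl h
      · exact Or.inr (Or.inr ⟨_, hmem, Or.inr h⟩)
      · exact absurd hyT (hqI _ h)
    · exact Or.inr (Or.inr ⟨_, hmem, Or.inr rfl⟩)
    · rcases ih hy with h | h | ⟨d, hd, h⟩
      · exact Or.inr (Or.inr ⟨_, hmem, Or.inl h⟩)
      · exact Or.inr (Or.inl h)
      · exact Or.inr (Or.inr ⟨d, by simp [hd], h⟩)

theorem AltDecomp.exists_of_mem_edges {TE : Set (Sym2 V)} {TV : Set V} {D : List (V × V)}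
    {a z : V} {P : G.Walk a z} (hP : AltDecomp G TE TV D a z P) {e : Sym2 V} (he : e ∈ P.edges)
    (heT : e ∈ TE) : ∃ d ∈ D, e = s(d.1, d.2) := by
  induction hP with
  | last rem a z q hq hqE hqI => exact absurd heT (hqE _ he)
  | cons rem₁ rem₂ a v u z q hq hqE hqI huv rest hrest ih =>
    rw [Walk.edges_append, List.mem_append, Walk.edges_cons, List.mem_cons] at he
    rcases he with he | rfl | he
    · exact absurd heT (hqE _ he)
    · exact ⟨(u, v), by simp, Sym2.eq_swap⟩
    · obtain ⟨d, hd, h⟩ := ih he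
      exact ⟨d, by simp [hd], h⟩

theorem exists_dart_of_sublist {b z : V} {q : G.Walk b z} {D : List (V × V)}
    (hD : D.Sublist (q.darts.map Dart.toProd)) {d : V × V} (hd : d ∈ D) :
    d.1 ∈ q.support ∧ d.2 ∈ q.support ∧ s(d.1, d.2) ∈ q.edges := by
  obtain ⟨d, hdq, rfl⟩ := List.mem_map.1 (hD.subset hd)
  exact ⟨q.dart_fst_mem_support_of_mem_darts hdq, q.dart_snd_mem_support_of_mem_darts hdq,
    List.mem_map.2 ⟨d, hdq, rfl⟩⟩

/-- An alternating walk `P` from `a` and a path `q` from `b`, both ending in `z`, can be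
recombined into two internally disjoint paths that use the edges in exactly one of them. -/
theorem AltDecomp.exists_disjoint_paths [DecidableEq V] {TE : Set (Sym2 V)} {TV : Set V}
    {D : List (V × V)} {a z : V} {P : G.Walk a z} (hP : AltDecomp G TE TV D a z P)
    (htr : P.IsTrail) (hcount : ∀ y ∉ TV, P.support.count y ≤ 1) (haT : a ∈ TV)
    {b : V} (q : G.Walk b z) (hq : q.IsPath) (hqE : ∀ e ∈ q.edges, e ∈ TE)
    (hqV : ∀ y ∈ q.support, y ∈ TV) (hD : D.Sublist (q.darts.map Dart.toProd))
    (hab : a ∈ q.support → a = b) :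
    ∃ (w₁ : G.Walk a z) (w₂ : G.Walk b z), w₁.IsPath ∧ w₂.IsPath ∧
      (∀ y ∈ w₁.support, y ∈ w₂.support → y = z ∨ (y = a ∧ a = b)) ∧
      (∀ e ∈ w₁.edges, e ∉ w₂.edges) ∧
      (∀ e, e ∈ w₁.edges ∨ e ∈ w₂.edges ↔
        (e ∈ P.edges ∧ e ∉ q.edges) ∨ (e ∈ q.edges ∧ e ∉ P.edges)) ∧
      (∀ y, y ∈ w₁.support ∨ y ∈ w₂.support ↔ y ∈ P.support ∨ y ∈ q.support) := by
  induction hP generalizing b with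
  | last rem a z p hp hpE hpI =>
    refine ⟨p, q, hp, hq, fun y hy hyq => ?_, fun e he heq => hpE e he (hqE e heq),
      fun e => ?_, fun y => Iff.rfl⟩
    · rcases mem_walkInterior_of_mem_support p hy with rfl | h | h
      · exact Or.inr ⟨rfl, hab hyq⟩
      · exact Or.inl h
      · exact absurd (hqV y hyq) (hpI y h)
    · have := hpE e
      have := hqE e
      tauto
  | cons rem₁ rem₂ a v u z p hp hpE hpI hvu rest hrest ih =>
    obtain ⟨huv, s, r, rfl, hr⟩ := exists_eq_append_cons_of_sublist_darts q
      ((List.sublist_append_right _ _).trans hD)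
    have hsupp : (p.append (.cons hvu rest)).support = p.support ++ rest.support := by
      rw [Walk.support_append, Walk.support_cons, List.tail_cons]
    have hsupq : (s.append (.cons huv r)).support = s.support ++ r.support := by
      rw [Walk.support_append, Walk.support_cons, List.tail_cons]
    have hsr := hq.support_nodup
    have hedges := hq.isTrail.edges_nodup
    have htr' := htr.edges_nodup
    rw [hsupp] at hcount
    rw [hsupq] at hsr hqV hab
    simp only [Walk.edges_append, Walk.edges_cons] at hedges htr' hqE
    simp only [List.count_append] at hcount
    rw [List.nodup_append'] at hsr hedges htr'
    obtain ⟨hs_nodup, hr_nodup, hsr⟩ := hsr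
    have hs : s.IsPath := (Walk.isPath_def s).2 hs_nodup
    have hus : u ∈ s.support := s.end_mem_support
    have hvr : v ∈ r.support := r.start_mem_support
    have hzr : z ∈ r.support := r.end_mem_support
    have hbs : b ∈ s.support := s.start_mem_support
    have hur : u ∉ r.support := fun h => hsr hus h
    obtain ⟨w₁, w₂, hw₁, hw₂, hint, hdisj, hE, hV⟩ := ih
      ((Walk.isTrail_cons _ _).1 htr.of_append_right).1
      (fun y hy => le_trans (Nat.le_add_left _ _) (hcount y hy))
      (hqV u (by simp)) r ((Walk.isPath_def r).2 hr_nodup)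
      (fun e he => hqE e (by simp [he])) (fun y hy => hqV y (by simp [hy])) hr
      (fun h => absurd h hur)
    have hrestV : ∀ y ∈ rest.support, y ∈ TV → y = u ∨ y ∈ r.support := by
      intro y hy hyT
      rcases hrest.eq_or_mem_of_mem_support hy hyT with h | rfl | ⟨d, hd, rfl | rfl⟩
      · exact Or.inl h
      · exact Or.inr hzr
      · exact Or.inr (exists_dart_of_sublist hr hd).1
      · exact Or.inr (exists_dart_of_sublist hr hd).2.1
    have hrestE : ∀ e ∈ rest.edges, e ∈ TE → e ∈ r.edges := by
      intro e he heT
      obtain ⟨d, hd, rfl⟩ := hrest.exists_of_mem_edges he heT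
      exact (exists_dart_of_sublist hr hd).2.2
    have hpI' : ∀ y ∈ walkInterior p, y ∉ s.support ∧ y ∉ w₁.support ∧ y ∉ w₂.support := by
      intro y hy
      have hyT := hpI y hy
      have hyp : y ∈ p.support := List.mem_of_mem_tail (List.mem_of_mem_dropLast hy)
      have h1 := hcount y hyT
      have h2 := List.count_pos_iff.2 hyp
      have h3 : y ∉ rest.support := fun h => by
        have := List.count_pos_iff.2 h
        omega
      have h4 : y ∉ r.support := fun h => hyT (hqV y (by simp [h]))
      have h5 := hV y
      exact ⟨fun h => hyT (hqV y (by simp [h])), fun h => (h5.1 (Or.inl h)).elim h3 h4,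
        fun h => (h5.1 (Or.inr h)).elim h3 h4⟩
    have hw : ∀ y ∈ TV, y ∈ w₁.support ∨ y ∈ w₂.support → y = u ∨ y ∈ r.support := by
      intro y hyT hy
      rcases (hV y).1 hy with h | h
      · exact hrestV y h hyT
      · exact Or.inr h
    have hint' : ∀ y ∈ w₁.support, y ∈ w₂.support → y = z := by
      intro y h1 h2
      rcases hint y h1 h2 with h | ⟨-, rfl⟩
      · exact h
      · exact absurd hvr hur
    have huw₂ : u ∉ w₂.support := fun h =>
      hur (hint' u w₁.start_mem_support h ▸ hzr)
    have hsw₂ : ∀ y ∈ s.support, y ∉ w₂.support := by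
      intro y hy hy2
      rcases hw y (hqV y (by simp [hy])) (Or.inr hy2) with rfl | h
      · exact huw₂ hy2
      · exact hsr hy h
    have har : a ∉ r.support := fun h => by
      have := hab (by simp [h])
      exact hsr hbs (this ▸ h)
    have haw₂ : a ∉ w₂.support := fun h => by
      rcases hw a haT (Or.inr h) with rfl | h'
      · exact huw₂ h
      · exact har h'
    have hwE : ∀ e, e ∈ w₁.edges ∨ e ∈ w₂.edges → e ∈ rest.edges ∨ e ∈ r.edges := by
      intro e he
      exact ((hE e).1 he).imp And.left And.left
    have hp_rest : ∀ e ∈ p.edges, e ∉ rest.edges := fun e he he' =>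
      htr'.2.2 he (List.mem_cons_of_mem _ he')
    refine ⟨p.append w₂, s.append w₁, isPath_append hp hw₂ ?_, isPath_append hs hw₁ ?_,
      ?_, ?_, ?_, ?_⟩
    · intro y hy hy2
      rcases mem_walkInterior_of_mem_support p hy with rfl | h | h
      · exact absurd hy2 haw₂
      · exact h
      · exact absurd hy2 (hpI' y h).2.2
    · intro y hy hy1
      rcases hw y (hqV y (by simp [hy])) (Or.inl hy1) with h | h
      · exact h
      · exact absurd h (fun h => hsr hy h)
    · intro y hy1 hy2
      rw [Walk.mem_support_append_iff] at hy1 hy2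
      rcases hy1 with hy1 | hy1
      · rcases mem_walkInterior_of_mem_support p hy1 with rfl | rfl | h
        · right
          refine ⟨rfl, hab ?_⟩
          rcases hy2 with h | h
          · simp [h]
          · rcases hw y haT (Or.inl h) with rfl | h
            · simp
            · simp [h]
        · rcases hy2 with h | h
          · exact absurd hvr (fun h' => hsr h h')
          · exact Or.inl (hint' y h w₂.start_mem_support)
        · exact absurd hy2 fun hy2 => hy2.elim (hpI' y h).1 (hpI' y h).2.1
      · rcases hy2 with h | h
        · exact absurd hy1 (hsw₂ y h)
        · exact Or.inl (hint' y h hy1)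
    · intro e he1 he2
      rw [Walk.edges_append, List.mem_append] at he1 he2
      rcases he1 with he1 | he1
      · have hnT := hpE e he1
        rcases he2 with h | h
        · exact hnT (hqE e (by simp [h]))
        · rcases hwE e (Or.inl h) with h | h
          · exact hp_rest e he1 h
          · exact hnT (hqE e (by simp [h]))
      · rcases he2 with h | h
        · induction e with | _ y y' =>
          exact hsw₂ y (s.fst_mem_support_of_mem_edges h) (w₂.fst_mem_support_of_mem_edges he1)
        · exact hdisj e h he1
    · intro e
      have h1 := hpE e
      have h2 := hqE e
      have h3 := hrestE e
      have h4 := hE e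
      have h5 : e ∈ s.edges → e ∉ r.edges := fun he he' =>
        hedges.2.2 he (List.mem_cons_of_mem _ he')
      have h6 : e = s(u, v) → e ∉ r.edges ∧ e ∉ s.edges ∧ e ∉ rest.edges := by
        rintro rfl
        refine ⟨(List.nodup_cons.1 hedges.2.1).1, fun h => hedges.2.2 h (by simp), ?_⟩
        rw [Sym2.eq_swap]
        exact (List.nodup_cons.1 htr'.2.1).1
      simp only [Walk.edges_append, Walk.edges_cons, List.mem_append, List.mem_cons,
        Sym2.eq_swap (a := v)] at h2 ⊢
      clear * - h1 h2 h3 h4 h5 h6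
      grind
    · intro y
      have := hV y
      simp only [Walk.mem_support_append_iff, Walk.support_cons, List.mem_cons]
      have h1 : y = u → y ∈ s.support := fun h => h ▸ hus
      have h2 : y = v → y ∈ p.support := fun h => h ▸ p.end_mem_support
      have h3 : y = v → y ∈ r.support := fun h => h ▸ hvr
      clear * - this h1 h2 h3
      grind

theorem isCycle_append_reverse {x z : V} {w₁ w₂ : G.Walk x z} (h₁ : w₁.IsPath) (h₂ : w₂.IsPath)
    (hxz : z ≠ x) (hV : ∀ y ∈ w₁.support, y ∈ w₂.support → y = z ∨ y = x)
    (hE : ∀ e ∈ w₁.edges, e ∉ w₂.edges) : (w₁.append w₂.reverse).IsCycle := by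
  have hn1 := h₁.support_nodup
  rw [← Walk.cons_tail_support, List.nodup_cons] at hn1
  have hn2 := h₂.reverse.support_nodup
  rw [← Walk.cons_tail_support, List.nodup_cons] at hn2
  refine ⟨⟨⟨?_⟩, ?_⟩, ?_⟩
  · rw [Walk.edges_append, Walk.edges_reverse]
    refine List.Nodup.append h₁.isTrail.edges_nodup
      (List.nodup_reverse.2 h₂.isTrail.edges_nodup) fun e he he' => ?_
    exact hE e he (List.mem_reverse.1 he')
  · intro h
    have := congrArg Walk.length h
    rw [Walk.length_append, Walk.length_nil, Nat.add_eq_zero_iff] at this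
    exact hxz (Walk.eq_of_length_eq_zero this.1).symm
  · rw [Walk.tail_support_append]
    refine List.Nodup.append hn1.2 hn2.2 fun y hy hy' => ?_
    have hy2 : y ∈ w₂.support := by
      simpa using List.mem_of_mem_tail hy'
    rcases hV y (List.mem_of_mem_tail hy) hy2 with rfl | rfl
    · exact hn2.1 hy'
    · exact hn1.1 hy

end AlternatingTrail

/-- Let `T` be a subtree of a finite graph `G`, `x` a leaf of `T`,
`z ≠ x` a vertex of `T`, and `q` the unique `x`–`z` path in `T` (so `P^{xz}` is its edge
set).  Let the designated edges, with orientations `(uᵢ, vᵢ)` where `uᵢ` is closer to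
`x`, form a sublist `D` of the darts of `q` (hence listed in order of increasing
distance from `x`).  If `P` is an alternating `x`–`z` trail, then the symmetric
difference `P △ P^{xz}` is the edge set of a cycle in `G` whose vertex set is exactly
the set of vertices visited by `P` or by `q`. -/
theorem stmt_12 {V : Type*} [Fintype V] [DecidableEq V] (G : SimpleGraph V)
    (T : G.Subgraph) (hT : T.coe.IsTree)
    (x z : V) (hx : x ∈ T.verts) (hz : z ∈ T.verts) (hxz : z ≠ x)
    (hleaf : (T.neighborSet x).ncard = 1)
    (q : G.Walk x z) (hq : q.IsPath) (hqT : ∀ e ∈ q.edges, e ∈ T.edgeSet)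
    (D : List (V × V)) (hD : D.Sublist (q.darts.map SimpleGraph.Dart.toProd))
    (P : G.Walk x z) (hP : IsAlternatingTrail G T.edgeSet T.verts D P) :
    ∃ (c : V) (w : G.Walk c c), w.IsCycle ∧
      w.edges.toFinset = symmDiff P.edges.toFinset q.edges.toFinset ∧
      w.support.toFinset = P.support.toFinset ∪ q.support.toFinset := by
  obtain ⟨htr, halt, hcount⟩ := hP
  have hqV : ∀ y ∈ q.support, y ∈ T.verts := by
    intro y hy
    rcases SimpleGraph.Walk.mem_support_iff_exists_mem_edges.1 hy with rfl | ⟨e, he, hye⟩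
    · exact hz
    · exact T.mem_verts_of_mem_edge (hqT e he) hye
  obtain ⟨w₁, w₂, h₁, h₂, hV, hE, hedges, hsupp⟩ := halt.exists_disjoint_paths htr hcount hx q hq
    hqT hqV hD fun _ => rfl
  refine ⟨x, w₁.append w₂.reverse, isCycle_append_reverse h₁ h₂ hxz
    (fun y hy hy' => (hV y hy hy').imp_right And.left) hE, ?_, ?_⟩
  · ext e
    simpa [Finset.mem_symmDiff, SimpleGraph.Walk.edges_append] using hedges e
  · ext y
    simpa [SimpleGraph.Walk.mem_support_append_iff] using hsupp y
end
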